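/- arXiv:0810.1186 — 3 statements merged into one kernel-verified Lean document; each statement's English description precedes it below -/
import Mathlib

section
/- Let Π be a planning instance with action set A, let s be a state, and let k ≥ 0. Every (H(s,k),A)-derivable action appears as an edge label in the action graph returned by compute_macros(H(s,k), A). -/
namespace OnTheFlyMacros

noncomputable section
attribute [local instance] Classical.propDecidable

variable {V : Type*} {Val : Type*}

/-- A partial state: a partial map from variables to values.
`vars p` is the set of variables where it is defined. -/
abbrev PState (V Val : Type*) := V → Option Val

/-- `vars(p)`, the set of variables on which the partial state is defined. -/
def pvars (p : PState V Val) : Set V := {v | p v ≠ none}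

/-- Restriction of a partial state to a set of variables. -/
def prestrict (p : PState V Val) (R : Set V) : PState V Val :=
  fun v => if v ∈ R then p v else none

/-- Union of partial states, viewed as sets of variable–value pairs
(left-biased; coincides with relational union for compatible partial states). -/
def punion (p q : PState V Val) : PState V Val :=
  fun v => (p v).orElse (fun _ => q v)

/-- Set difference of partial states viewed as sets of variable–value pairs. -/
def pdiff (p q : PState V Val) : PState V Val :=
  fun v =>
    match p v with
    | none => none
    | some x => if q v = some x then none else some x

/-- Containment of partial states viewed as sets of variable–value pairs. -/
def psub (p q : PState V Val) : Prop := ∀ v x, p v = some x → q v = some x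

/-- Strict containment of partial states viewed as sets of variable–value pairs. -/
def psubStrict (p q : PState V Val) : Prop := psub p q ∧ ¬ psub q p

/-- An action: a pair of a precondition and a postcondition. -/
structure PAct (V Val : Type*) where
  pre : PState V Val
  post : PState V Val

/-- The `combine` operation on actions. -/
def combine (a a' : PAct V Val) : PAct V Val :=
  let R := pvars a.pre \ pvars a.post
  let S := punion a.post (prestrict a.pre R)
  let O := pvars a.post \ pvars a'.post
  let pr := punion a.pre (pdiff a'.pre S)
  let pos := punion a'.post (prestrict a.post O)
  ⟨pr, pdiff pos pr⟩

/-- `a` is applicable at state `s`: `s` agrees with `pre(a)` on `vars(pre(a))`. -/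
def Applicable (s : V → Val) (a : PAct V Val) : Prop :=
  ∀ v x, a.pre v = some x → s v = x

/-- `s[a]`: the result of applying action `a` at state `s`. -/
def appA (s : V → Val) (a : PAct V Val) : V → Val :=
  if Applicable s a then (fun v => (a.post v).getD (s v)) else s

/-- `s[P]`: the result of applying a plan `P` at state `s`. -/
def appP (s : V → Val) (P : List (PAct V Val)) : V → Val := P.foldl appA s

/-- Hamming distance between two states. -/
def ham (s t : V → Val) : ℕ := Set.ncard {v | s v ≠ t v}

/-- `H(s,k)`: all states (respecting the variable domains `D`) within Hamming
distance `k` of `s`. -/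
def Hball (D : V → Set Val) (s : V → Val) (k : ℕ) : Set (V → Val) :=
  {t | (∀ v, t v ∈ D v) ∧ ham s t ≤ k}

/-- A partial state given by a finite list of variable–value pairs. -/
def pOf {V Val : Type*} [DecidableEq V] (l : List (V × Val)) : PState V Val :=
  fun v => (l.find? (fun q => decide (q.1 = v))).map Prod.snd

/-- An action graph: vertices are states, each present edge has exactly one
action label (`label s s' = some a` means there is an edge `(s,s')` with label `a`). -/
structure AGraph (V Val : Type*) where
  verts : Set (V → Val)
  label : (V → Val) → (V → Val) → Option (PAct V Val)

/-- `a` appears as an edge label in `G`. -/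
def IsEdgeLabel (G : AGraph V Val) (a : PAct V Val) : Prop :=
  ∃ s s', G.label s s' = some a

/-- The `better` test. -/
def better (a : PAct V Val) (s s' : V → Val) (G : AGraph V Val) : Prop :=
  match G.label s s' with
  | none => True
  | some b =>
      (psubStrict a.pre b.pre ∧ psub a.post b.post) ∨
      (psub a.pre b.pre ∧ psubStrict a.post b.post)

/-- The `addlabel` operation. -/
def addlabel (G : AGraph V Val) (s s' : V → Val) (a : PAct V Val) : AGraph V Val :=
  ⟨G.verts, fun t t' => if t = s ∧ t' = s' then some a else G.label t t'⟩

/-- The `apply` operation on action graphs. -/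
def applyCmd (G : AGraph V Val) (A : Set (PAct V Val)) (a : PAct V Val) (s : V → Val) :
    AGraph V Val :=
  if (a ∈ A ∨ IsEdgeLabel G a) ∧ appA s a ≠ s ∧ appA s a ∈ G.verts ∧
      better a s (appA s a) G
  then addlabel G s (appA s a) a
  else G

/-- The `transitive` operation on action graphs. -/
def transCmd (G : AGraph V Val) (s1 s2 s3 : V → Val) : AGraph V Val :=
  match G.label s1 s2, G.label s2 s3 with
  | some a, some a' =>
      if better (combine a a') s1 s3 G then addlabel G s1 s3 (combine a a') else G
  | _, _ => G

/-- `transitive(G,s1,s2,s3)` produces the transition `(s1, b, s3)`. -/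
def ProducesTr (G : AGraph V Val) (s1 s2 s3 : V → Val) (b : PAct V Val) : Prop :=
  ∃ a a', G.label s1 s2 = some a ∧ G.label s2 s3 = some a' ∧
    better (combine a a') s1 s3 G ∧ b = combine a a'

/-- A command of an action graph program. -/
inductive Cmd (V Val : Type*) where
  | app : PAct V Val → (V → Val) → Cmd V Val
  | tr : (V → Val) → (V → Val) → (V → Val) → Cmd V Val

/-- The states mentioned by a command all belong to `S`. -/
def CmdOver (S : Set (V → Val)) : Cmd V Val → Prop
  | .app _ s => s ∈ S
  | .tr s1 s2 s3 => s1 ∈ S ∧ s2 ∈ S ∧ s3 ∈ S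

/-- Executing one command (with action set `A`). -/
def stepCmd (A : Set (PAct V Val)) (G : AGraph V Val) : Cmd V Val → AGraph V Val
  | .app a s => applyCmd G A a s
  | .tr s1 s2 s3 => transCmd G s1 s2 s3

/-- Executing an action graph program starting from graph `G`. -/
def execFrom (A : Set (PAct V Val)) (G : AGraph V Val) (prog : List (Cmd V Val)) :
    AGraph V Val :=
  prog.foldl (stepCmd A) G

/-- The edgeless action graph with vertex set `S`. -/
def emptyGraph (S : Set (V → Val)) : AGraph V Val := ⟨S, fun _ _ => none⟩

/-- Combinations over `A`: actions of `A` closed under `combine`. -/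
inductive Comb (A : Set (PAct V Val)) : PAct V Val → Prop
  | base {a} : a ∈ A → Comb A a
  | comb {a a'} : Comb A a → Comb A a' → Comb A (combine a a')

/-- The transition `(s,a,s')` is condition-minimal with respect to `A`. -/
def CondMin (A : Set (PAct V Val)) (s : V → Val) (a : PAct V Val) (s' : V → Val) : Prop :=
  Applicable s a ∧ appA s a = s' ∧
    ∀ b, Comb A b → appA s b = s' → psub a.pre b.pre ∧ psub a.post b.post

/-- The program, executed from graph `G` with action set `A'`, passes `apply` only
condition-minimal (w.r.t. `A`) pairs and its `transitive` commands produce only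
condition-minimal (w.r.t. `A`) transitions. -/
def IsCMFrom (A A' : Set (PAct V Val)) : AGraph V Val → List (Cmd V Val) → Prop
  | _, [] => True
  | G, (.app a s) :: rest =>
      CondMin A s a (appA s a) ∧ IsCMFrom A A' (applyCmd G A' a s) rest
  | G, (.tr s1 s2 s3) :: rest =>
      (∀ b, ProducesTr G s1 s2 s3 b → CondMin A s1 b s3) ∧
      IsCMFrom A A' (transCmd G s1 s2 s3) rest

/-- Some `transitive` command of the program (executed from `G` with action set `A'`)
produces a transition whose action is `b`. -/
def ProducesIn (A' : Set (PAct V Val)) : AGraph V Val → List (Cmd V Val) → PAct V Val → Prop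
  | _, [], _ => False
  | G, (.app a s) :: rest, b => ProducesIn A' (applyCmd G A' a s) rest b
  | G, (.tr s1 s2 s3) :: rest, b =>
      ProducesTr G s1 s2 s3 b ∨ ProducesIn A' (transCmd G s1 s2 s3) rest b

/-- `b` is the action of a transition produced by some `A`-CM-program over states `S`
and actions `A'`. -/
def ProducedOver (S : Set (V → Val)) (A A' : Set (PAct V Val)) (b : PAct V Val) : Prop :=
  ∃ prog : List (Cmd V Val), (∀ c ∈ prog, CmdOver S c) ∧
    IsCMFrom A A' (emptyGraph S) prog ∧ ProducesIn A' (emptyGraph S) prog b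

/-- The set of `(S,A)`-derivable actions: the smallest set `X` of actions such that
any action of a transition produced by an `A`-CM-program over states `S` and the
actions `X ∪ A` belongs to `X`. -/
def Derivable (S : Set (V → Val)) (A : Set (PAct V Val)) : Set (PAct V Val) :=
  ⋂₀ {X : Set (PAct V Val) | ∀ b, ProducedOver S A (X ∪ A) b → b ∈ X}

/-- `s` is a goal state for the partial state `goal`. -/
def GoalSt (goal : PState V Val) (s : V → Val) : Prop :=
  ∀ v x, goal v = some x → s v = x

/-- `wrong(s)`: variables of `vars(goal)` not at their goal value. -/
def wrongSet (goal : PState V Val) (s : V → Val) : Set V :=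
  {v | ∃ x, goal v = some x ∧ s v ≠ x}

/-- `s'` is an improvement of `s`. -/
def Improvement (goal : PState V Val) (s s' : V → Val) : Prop :=
  (∀ v x, goal v = some x → s v = x → s' v = x) ∧
  (∃ u x, goal u = some x ∧ s u ≠ x ∧ s' u = x)

/-- The plan `P` improves the state `s`. -/
def PlanImproves (goal : PState V Val) (s : V → Val) (P : List (PAct V Val)) : Prop :=
  GoalSt goal (appP s P) ∨ Improvement goal s (appP s P)

/-- The plan `P`, executed from `s`, stays within Hamming distance `k` of `s`
(all intermediate states and the final state). -/
def StaysWithin (k : ℕ) (s : V → Val) (P : List (PAct V Val)) : Prop :=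
  ∀ Q : List (PAct V Val), Q <+: P → ham s (appP s Q) ≤ k

/-- `s` dominates `s0`. -/
def Dominates (goal : PState V Val) (s s0 : V → Val) : Prop :=
  {v | s v ≠ s0 v} ⊆ pvars goal ∧ wrongSet goal s ⊆ wrongSet goal s0

/-- `s` is reachable from `init` by a plan over `A`. -/
def Reachable (A : Set (PAct V Val)) (init s : V → Val) : Prop :=
  ∃ P : List (PAct V Val), (∀ a ∈ P, a ∈ A) ∧ appP init P = s

/-- Some plan over `A` solves the instance. -/
def Solvable (init : V → Val) (goal : PState V Val) (A : Set (PAct V Val)) : Prop :=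
  ∃ P : List (PAct V Val), (∀ a ∈ P, a ∈ A) ∧ GoalSt goal (appP init P)

/-- The instance has persistent Hamming width `k`. -/
def PHWidth (init : V → Val) (goal : PState V Val) (A : Set (PAct V Val)) (k : ℕ) : Prop :=
  ¬ Solvable init goal A ∨
    ∀ s : V → Val, Reachable A init s →
      ∃ P : List (PAct V Val), (∀ a ∈ P, a ∈ A) ∧ PlanImproves goal s P ∧ StaysWithin k s P

/-- The instance has macro persistent Hamming width `k`. -/
def MPHWidth (D : V → Set Val) (init : V → Val) (goal : PState V Val)
    (A : Set (PAct V Val)) (k : ℕ) : Prop :=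
  ¬ Solvable init goal A ∨
    ∀ s : V → Val, Reachable A init s → Dominates goal s init →
      ∃ P : List (PAct V Val), (∀ a ∈ P, a ∈ Derivable (Hball D s k) A) ∧
        PlanImproves goal s P ∧ StaysWithin k s P

end

end OnTheFlyMacros

namespace OnTheFlyMacros

noncomputable section
attribute [local instance] Classical.propDecidable

variable {V : Type*} {Val : Type*}

/-- `G` is a fixed point of all `apply` and `transitive` commands. -/
def GraphFixed (A : Set (PAct V Val)) (G : AGraph V Val) : Prop :=
  (∀ a : PAct V Val, ∀ s ∈ G.verts, applyCmd G A a s = G) ∧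
  (∀ s1 s2 s3 : V → Val, s1 ∈ G.verts → s2 ∈ G.verts → s3 ∈ G.verts →
    transCmd G s1 s2 s3 = G)

/-- `G` is the action graph returned by `compute_macros(S, A)`: it is obtained
from the edgeless graph on `S` by executing `apply`/`transitive` commands over
`S` (in some order), and it is a fixed point of all such commands. -/
def ComputeMacrosResult (S : Set (V → Val)) (A : Set (PAct V Val)) (G : AGraph V Val) :
    Prop :=
  (∃ prog : List (Cmd V Val), (∀ c ∈ prog, CmdOver S c) ∧
      G = execFrom A (emptyGraph S) prog) ∧
  GraphFixed A G

theorem psub_antisymm {p q : PState V Val} (h : psub p q) (h' : psub q p) : p = q := by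
  funext v
  exact Option.ext fun x => ⟨h v x, h' v x⟩

theorem appA_combine {s₁ s₂ s₃ : V → Val} {a a' : PAct V Val}
    (ha : Applicable s₁ a) (h : appA s₁ a = s₂)
    (ha' : Applicable s₂ a') (h' : appA s₂ a' = s₃) :
    Applicable s₁ (combine a a') ∧ appA s₁ (combine a a') = s₃ := by
  have e₂ : ∀ v, s₂ v = (a.post v).getD (s₁ v) := by
    intro v; rw [← h, appA, if_pos ha]
  have e₃ : ∀ v, s₃ v = (a'.post v).getD (s₂ v) := by
    intro v; rw [← h', appA, if_pos ha']
  have happ : Applicable s₁ (combine a a') := by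
    intro v x hx
    have h₁ := ha v
    have h₂ := ha' v
    rw [e₂ v] at h₂
    revert hx h₁ h₂
    cases hp : a.pre v <;> cases hq : a.post v <;> cases hr : a'.pre v <;>
      simp [combine, punion, pdiff, prestrict, pvars, hp, hq, hr]
    all_goals grind
  refine ⟨happ, ?_⟩
  rw [appA, if_pos happ]
  funext v
  have h₁ := happ v
  rw [e₃ v, e₂ v]
  have hpost : (combine a a').post v =
      pdiff (punion a'.post (prestrict a.post (pvars a.post \ pvars a'.post)))
        (combine a a').pre v := rfl
  rw [hpost]
  revert h₁
  cases hp : (combine a a').pre v <;> cases hq : a.post v <;> cases hr : a'.post v <;>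
    simp [punion, pdiff, prestrict, pvars, hp, hq, hr]
  all_goals grind

/-- Every edge label is a combination over `A` that induces its edge. -/
def LabelsSound (A : Set (PAct V Val)) (G : AGraph V Val) : Prop :=
  ∀ s s' a, G.label s s' = some a → Comb A a ∧ Applicable s a ∧ appA s a = s'

theorem addlabel_eq_some {G : AGraph V Val} {s s' t t' : V → Val} {a b : PAct V Val}
    (h : (addlabel G s s' a).label t t' = some b) :
    (t = s ∧ t' = s' ∧ b = a) ∨ G.label t t' = some b := by
  simp only [addlabel] at h
  split_ifs at h with hc
  · exact Or.inl ⟨hc.1, hc.2, (Option.some.inj h).symm⟩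
  · exact Or.inr h

theorem LabelsSound.addlabel {A : Set (PAct V Val)} {G : AGraph V Val} (hG : LabelsSound A G)
    {s s' : V → Val} {a : PAct V Val} (hc : Comb A a) (ha : Applicable s a)
    (hs : appA s a = s') : LabelsSound A (addlabel G s s' a) := by
  intro t t' b h
  rcases addlabel_eq_some h with ⟨rfl, rfl, rfl⟩ | h
  · exact ⟨hc, ha, hs⟩
  · exact hG _ _ _ h

theorem LabelsSound.applyCmd {A : Set (PAct V Val)} {G : AGraph V Val} (hG : LabelsSound A G)
    (a : PAct V Val) (s : V → Val) : LabelsSound A (applyCmd G A a s) := by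
  unfold OnTheFlyMacros.applyCmd
  split_ifs with h
  · refine hG.addlabel ?_ ?_ rfl
    · rcases h.1 with ha | ⟨t, t', ha⟩
      · exact .base ha
      · exact (hG _ _ _ ha).1
    · by_contra hn
      exact h.2.1 (if_neg hn)
  · exact hG

/-- A `transitive` command either leaves the graph unchanged or adds the transition it
produces. -/
theorem transCmd_cases (G : AGraph V Val) (s₁ s₂ s₃ : V → Val) :
    transCmd G s₁ s₂ s₃ = G ∨
      ∃ b, ProducesTr G s₁ s₂ s₃ b ∧ transCmd G s₁ s₂ s₃ = addlabel G s₁ s₃ b := by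
  by_cases h : ∃ b, ProducesTr G s₁ s₂ s₃ b
  · obtain ⟨b, a, a', h₁, h₂, hb, rfl⟩ := h
    exact Or.inr ⟨_, ⟨a, a', h₁, h₂, hb, rfl⟩, by simp [transCmd, h₁, h₂, hb]⟩
  · left
    unfold transCmd
    split
    · rename_i a a' h₁ h₂
      exact if_neg fun hb => h ⟨_, a, a', h₁, h₂, hb, rfl⟩
    · rfl

theorem LabelsSound.transCmd {A : Set (PAct V Val)} {G : AGraph V Val} (hG : LabelsSound A G)
    (s₁ s₂ s₃ : V → Val) : LabelsSound A (transCmd G s₁ s₂ s₃) := by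
  rcases transCmd_cases G s₁ s₂ s₃ with h | ⟨b, ⟨a, a', h₁, h₂, -, rfl⟩, h⟩
  · rwa [h]
  · rw [h]
    obtain ⟨c₁, p₁, e₁⟩ := hG _ _ _ h₁
    obtain ⟨c₂, p₂, e₂⟩ := hG _ _ _ h₂
    obtain ⟨p, e⟩ := appA_combine p₁ e₁ p₂ e₂
    exact hG.addlabel (.comb c₁ c₂) p e

theorem applyCmd_verts (G : AGraph V Val) (A : Set (PAct V Val)) (a : PAct V Val)
    (s : V → Val) : (applyCmd G A a s).verts = G.verts := by
  unfold applyCmd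
  split_ifs <;> rfl

theorem transCmd_verts (G : AGraph V Val) (s₁ s₂ s₃ : V → Val) :
    (transCmd G s₁ s₂ s₃).verts = G.verts := by
  rcases transCmd_cases G s₁ s₂ s₃ with h | ⟨b, -, h⟩ <;> rw [h]
  rfl

theorem execFrom_sound {A : Set (PAct V Val)} (prog : List (Cmd V Val)) :
    ∀ {G : AGraph V Val}, LabelsSound A G →
      LabelsSound A (execFrom A G prog) ∧ (execFrom A G prog).verts = G.verts := by
  induction prog with
  | nil => exact fun hG => ⟨hG, rfl⟩
  | cons c rest ih =>
    intro G hG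
    cases c with
    | app a s =>
      obtain ⟨h, hv⟩ := ih (hG.applyCmd a s)
      exact ⟨h, hv.trans (applyCmd_verts G A a s)⟩
    | tr s₁ s₂ s₃ =>
      obtain ⟨h, hv⟩ := ih (hG.transCmd s₁ s₂ s₃)
      exact ⟨h, hv.trans (transCmd_verts G s₁ s₂ s₃)⟩

theorem not_better_self {G : AGraph V Val} {s s' : V → Val} {a : PAct V Val}
    (h : G.label s s' = some a) : ¬ better a s s' G := by
  simp only [better, h, psubStrict]
  tauto

theorem not_better_of_addlabel_eq {G : AGraph V Val} {s s' : V → Val} {a : PAct V Val}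
    (h : addlabel G s s' a = G) : ¬ better a s s' G := by
  apply not_better_self
  rw [← h]
  simp [addlabel]

/-- If a condition-minimal transition does not improve on a sound graph, then it is already
a transition of that graph. -/
theorem CondMin.label_eq {A : Set (PAct V Val)} {G : AGraph V Val} (hG : LabelsSound A G)
    {s s' : V → Val} {a : PAct V Val} (hmin : CondMin A s a s') (hb : ¬ better a s s' G) :
    G.label s s' = some a := by
  cases hl : G.label s s' with
  | none => simp [better, hl] at hb
  | some b =>
    obtain ⟨hc, -, hs⟩ := hG _ _ _ hl
    obtain ⟨hpre, hpost⟩ := hmin.2.2 b hc hs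
    simp only [better, hl, psubStrict] at hb
    have h₁ : psub b.pre a.pre := by tauto
    have h₂ : psub b.post a.post := by tauto
    cases a
    cases b
    simp only [Option.some.injEq, PAct.mk.injEq]
    exact ⟨psub_antisymm h₁ hpre, psub_antisymm h₂ hpost⟩

/-- Every transition of `H` is a transition of `G`, with the same label. -/
def LabelsLE (H G : AGraph V Val) : Prop :=
  ∀ s s' a, H.label s s' = some a → G.label s s' = some a

theorem LabelsLE.addlabel {H G : AGraph V Val} (h : LabelsLE H G) {s s' : V → Val}
    {a : PAct V Val} (ha : G.label s s' = some a) : LabelsLE (addlabel H s s' a) G := by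
  intro t t' b hb
  rcases addlabel_eq_some hb with ⟨rfl, rfl, rfl⟩ | hb
  · exact ha
  · exact h _ _ _ hb

theorem LabelsLE.applyCmd {A : Set (PAct V Val)} {G H : AGraph V Val} (hG : LabelsSound A G)
    (hfix : GraphFixed A G) (hv : H.verts = G.verts) (hle : LabelsLE H G)
    {a : PAct V Val} {s : V → Val} (hs : s ∈ G.verts) (hmin : CondMin A s a (appA s a)) :
    LabelsLE (applyCmd H ({c | IsEdgeLabel G c} ∪ A) a s) G := by
  unfold OnTheFlyMacros.applyCmd
  split_ifs with h
  · obtain ⟨hmem, hne, hvert, -⟩ := h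
    have hmem' : a ∈ A ∨ IsEdgeLabel G a := by
      rcases hmem with (h | h) | ⟨t, t', h⟩
      · exact Or.inr h
      · exact Or.inl h
      · exact Or.inr ⟨t, t', hle _ _ _ h⟩
    refine hle.addlabel (hmin.label_eq hG fun hb => ?_)
    have hf := hfix.1 a s hs
    rw [OnTheFlyMacros.applyCmd, if_pos ⟨hmem', hne, hv ▸ hvert, hb⟩] at hf
    exact not_better_of_addlabel_eq hf hb
  · exact hle

theorem label_eq_of_producesTr {A : Set (PAct V Val)} {G H : AGraph V Val}
    (hG : LabelsSound A G) (hfix : GraphFixed A G) (hle : LabelsLE H G)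
    {s₁ s₂ s₃ : V → Val} (h₁ : s₁ ∈ G.verts) (h₂ : s₂ ∈ G.verts) (h₃ : s₃ ∈ G.verts)
    {b : PAct V Val} (hmin : CondMin A s₁ b s₃) (hb : ProducesTr H s₁ s₂ s₃ b) :
    G.label s₁ s₃ = some b := by
  obtain ⟨a, a', l₁, l₂, -, rfl⟩ := hb
  refine hmin.label_eq hG fun hbet => ?_
  have hf := hfix.2 s₁ s₂ s₃ h₁ h₂ h₃
  simp only [transCmd, hle _ _ _ l₁, hle _ _ _ l₂, if_pos hbet] at hf
  exact not_better_of_addlabel_eq hf hbet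

theorem isEdgeLabel_of_producesIn {A : Set (PAct V Val)} {G : AGraph V Val}
    (hG : LabelsSound A G) (hfix : GraphFixed A G) {b : PAct V Val}
    (prog : List (Cmd V Val)) :
    ∀ {H : AGraph V Val}, (∀ c ∈ prog, CmdOver G.verts c) → H.verts = G.verts →
      LabelsLE H G → IsCMFrom A ({c | IsEdgeLabel G c} ∪ A) H prog →
      ProducesIn ({c | IsEdgeLabel G c} ∪ A) H prog b → IsEdgeLabel G b := by
  induction prog with
  | nil => exact fun _ _ _ _ h => h.elim
  | cons c rest ih =>
    intro H hover hv hle hcm hprod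
    have hover' : ∀ c ∈ rest, CmdOver G.verts c := fun c hc => hover c (.tail _ hc)
    have hc := hover c List.mem_cons_self
    cases c with
    | app a s =>
      exact ih hover' ((applyCmd_verts _ _ _ _).trans hv)
        (hle.applyCmd hG hfix hv hc hcm.1) hcm.2 hprod
    | tr s₁ s₂ s₃ =>
      obtain ⟨h₁, h₂, h₃⟩ := hc
      have key : ∀ b, ProducesTr H s₁ s₂ s₃ b → G.label s₁ s₃ = some b := fun b hb =>
        label_eq_of_producesTr hG hfix hle h₁ h₂ h₃ (hcm.1 b hb) hb
      rcases hprod with hb | hprod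
      · exact ⟨_, _, key b hb⟩
      · refine ih hover' ((transCmd_verts _ _ _ _).trans hv) ?_ hcm.2 hprod
        rcases transCmd_cases H s₁ s₂ s₃ with h | ⟨b', hb', h⟩
        · rwa [h]
        · rw [h]
          exact hle.addlabel (key b' hb')

/-- Every `(H(s,k),A)`-derivable action appears as an edge label in the graph
returned by `compute_macros(H(s,k), A)`. -/
theorem derivable_discovered_by_compute_macros [Fintype V]
    (D : V → Set Val) (hDfin : ∀ v, (D v).Finite)
    (A : Set (PAct V Val)) (hA : A.Finite)
    (s : V → Val) (hsD : ∀ v, s v ∈ D v) (k : ℕ)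
    (b : PAct V Val) (hb : b ∈ Derivable (Hball D s k) A)
    (G : AGraph V Val) (hG : ComputeMacrosResult (Hball D s k) A G) :
    IsEdgeLabel G b := by
  obtain ⟨⟨prog, -, hprog⟩, hfix⟩ := hG
  have hempty : LabelsSound A (emptyGraph (Hball D s k)) := fun _ _ _ h => nomatch h
  obtain ⟨hsound, hverts⟩ := execFrom_sound prog hempty
  rw [← hprog] at hsound hverts
  have hverts' : G.verts = Hball D s k := hverts
  refine hb {c | IsEdgeLabel G c} ?_
  rintro c ⟨prog', hover, hcm, hprod⟩
  exact isEdgeLabel_of_producesIn hsound hfix prog' (hverts' ▸ hover) hverts.symm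
    (fun _ _ _ h => nomatch h) hcm hprod

end

end OnTheFlyMacros
end

section
/- Let a and a' be actions and let s be a state of a planning instance such that a is applicable at s and a' is applicable at s[a]. Then s[combine(a,a')] = s[a,a'], i.e., applying combine(a,a') to s yields the same state as applying a and then a'. -/
namespace OnTheFlyMacros

noncomputable section
attribute [local instance] Classical.propDecidable

variable {V : Type*} {Val : Type*}

end

end OnTheFlyMacros

namespace OnTheFlyMacros

noncomputable section
attribute [local instance] Classical.propDecidable

/-- Removing from `p` pairs of `q` that already hold in the state does not change the update. -/
theorem getD_pdiff {V Val : Type*} {p q : PState V Val} {v : V} {y : Val}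
    (h : ∀ x, q v = some x → y = x) : (pdiff p q v).getD y = (p v).getD y := by
  unfold pdiff
  cases p v <;> grind

/-- `combine a a'` is applicable whenever `a` and then `a'` are. -/
theorem applicable_combine {V Val : Type*} {a a' : PAct V Val} {s : V → Val}
    (h1 : Applicable s a) (h2 : Applicable (appA s a) a') :
    Applicable s (combine a a') := by
  intro v x
  have h1v := h1 v
  have h2v := h2 v
  simp only [appA, if_pos h1] at h2v
  simp only [combine, punion, pdiff, prestrict, pvars, Set.mem_sdiff, Set.mem_ofPred_eq]
  cases hp : a.pre v <;> cases hq : a.post v <;> cases hp' : a'.pre v <;> simp_all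

/-- When applicable, `s[combine(a,a')] = s[a,a']`. -/
theorem combine_app_eq {V Val : Type*} [Fintype V]
    (a a' : PAct V Val) (s : V → Val)
    (h1 : Applicable s a) (h2 : Applicable (appA s a) a') :
    appA s (combine a a') = appP s [a, a'] := by
  have hc := applicable_combine h1 h2
  simp only [appP, List.foldl_cons, List.foldl_nil]
  rw [appA, if_pos hc, appA, if_pos h2]
  funext v
  refine (getD_pdiff (hc v)).trans ?_
  simp only [appA, if_pos h1, punion, prestrict, pvars, Set.mem_sdiff, Set.mem_ofPred_eq]
  cases hq : a.post v <;> cases hq' : a'.post v <;> simp_all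

end

end OnTheFlyMacros
end

section
/- The function combine is associative: if a1, a2, a3 are actions of a planning instance and there exists a state s such that a1 is applicable at s, a2 is applicable at s[a1], and a3 is applicable at s[a1,a2], then combine(combine(a1,a2), a3) = combine(a1, combine(a2,a3)). -/
namespace OnTheFlyMacros

noncomputable section
attribute [local instance] Classical.propDecidable

variable {V : Type*} {Val : Type*}

end

end OnTheFlyMacros

namespace OnTheFlyMacros

noncomputable section
attribute [local instance] Classical.propDecidable

/-- `combine` is associative (under the applicability assumption). -/
theorem combine_assoc {V Val : Type*} [Fintype V] (a1 a2 a3 : PAct V Val)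
    (h : ∃ s : V → Val, Applicable s a1 ∧ Applicable (appA s a1) a2 ∧
        Applicable (appP s [a1, a2]) a3) :
    combine (combine a1 a2) a3 = combine a1 (combine a2 a3) := by
  obtain ⟨s, h1, h2, h3⟩ := h
  have h12 : appP s [a1, a2] = appA (appA s a1) a2 := rfl
  rw [h12, appA, if_pos h2] at h3
  rw [appA, if_pos h1] at h2 h3
  have pointwise (v : V) :
      (combine (combine a1 a2) a3).pre v = (combine a1 (combine a2 a3)).pre v ∧
      (combine (combine a1 a2) a3).post v = (combine a1 (combine a2 a3)).post v := by
    have e1 := h1 v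
    have e2 := h2 v
    have e3 := h3 v
    simp only [combine, punion, pdiff, prestrict, pvars, Set.mem_sdiff, Set.mem_ofPred_eq]
    rcases hp1 : a1.pre v with _ | x1 <;> rcases hq1 : a1.post v with _ | y1 <;>
    rcases hp2 : a2.pre v with _ | x2 <;> rcases hq2 : a2.post v with _ | y2 <;>
    rcases hp3 : a3.pre v with _ | x3 <;> rcases hq3 : a3.post v with _ | y3 <;>
    simp_all <;> grind
  have hpre := funext fun v => (pointwise v).1
  have hpost := funext fun v => (pointwise v).2
  exact (PAct.mk.injEq _ _ _ _).mpr ⟨hpre, hpost⟩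

end

end OnTheFlyMacros
end
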